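/- Let (X, 𝓕, μ) be a probability space and let T : X → X be a measurable bijection with measurable inverse which is measure preserving and ergodic with respect to μ. Let A be a measurable set with μ(A) > 0, let n(x) = min{k ≥ 1 : T^k x ∈ A} be the first return time to A (with the convention n(x) = 0 if no such k exists), and let S(x) = T^{n(x)}(x) be the induced transformation. Then S is ergodic with respect to the conditional probability measure μ(· | A): every measurable set B with S⁻¹(B) = B satisfies μ(B | A) ∈ {0, 1}. -/

import Mathlib

open MeasureTheory Set Function

/-- Almost every point enters a set of positive measure under an ergodic map. -/
theorem Ergodic.ae_exists_iterate_mem {X : Type*} [MeasurableSpace X] {μ : Measure X}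
    [IsFiniteMeasure μ] {T : X → X} (hT : Ergodic T μ) {A : Set X} (hA : MeasurableSet A)
    (hApos : 0 < μ A) : ∀ᵐ x ∂μ, ∃ k, 1 ≤ k ∧ T^[k] x ∈ A := by
  set E : Set X := ⋂ k : ℕ, T^[k + 1] ⁻¹' Aᶜ with hE
  have hEm : MeasurableSet E :=
    MeasurableSet.iInter fun k => hT.measurable.iterate (k + 1) hA.compl
  have hsub : E ⊆ T ⁻¹' E := fun x hx => by
    simp only [hE, mem_iInter, mem_preimage] at hx ⊢
    exact fun k => hx (k + 1)
  rcases hT.ae_empty_or_univ_of_ae_le_preimage hEm.nullMeasurableSet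
    hsub.eventuallyLE with h | h
  · filter_upwards [h.mem_iff] with x hx
    by_contra! hne
    exact (hx.1 (mem_iInter.2 fun k => hne (k + 1) (Nat.le_add_left 1 k))).elim
  · have hnull : μ (T ⁻¹' A) = 0 := by
      have hAE : T ⁻¹' A ⊆ Eᶜ := fun x hx hxE => mem_iInter.1 hxE 0 hx
      exact measure_mono_null hAE (ae_eq_univ.1 h)
    rw [hT.measure_preimage hA.nullMeasurableSet] at hnull
    exact absurd hnull hApos.ne'

/-- A set invariant under the induced transformation does not distinguish a point with a return
time from its image. -/
theorem mem_iff_apply_mem_of_induced_invariant {X : Type*} {T S : X → X} {A B : Set X} {n : X → ℕ}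
    (hn : ∀ x, n x = sInf {k : ℕ | 1 ≤ k ∧ T^[k] x ∈ A}) (hS : ∀ x, S x = T^[n x] x)
    (hB : S ⁻¹' B = B) {x : X} (hx : ∃ k, 1 ≤ k ∧ T^[k] x ∈ A) : T x ∈ B ↔ x ∈ B := by
  have hmem (y : X) : S y ∈ B ↔ y ∈ B := Set.ext_iff.1 hB y
  by_cases hTx : T x ∈ A
  · have h1 : n x = 1 := by
      rw [hn]
      exact le_antisymm (Nat.sInf_le ⟨le_rfl, hTx⟩) (Nat.sInf_mem hx).1
    rw [← hmem x, hS, h1, iterate_one]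
  · have hxn : 1 ≤ n x ∧ T^[n x] x ∈ A := by
      rw [hn]
      exact Nat.sInf_mem hx
    have hlt : 2 ≤ n x := by
      rcases hxn.1.eq_or_lt with h | h
      · exact absurd (by simpa [← h] using hxn.2) hTx
      · exact h
    obtain ⟨m, hm⟩ : ∃ m, n x = m + 1 := ⟨n x - 1, by omega⟩
    have hTm : 1 ≤ m ∧ T^[m] (T x) ∈ A := ⟨by omega, by simpa [hm] using hxn.2⟩
    have hTn : n (T x) = m := by
      rw [hn (T x)]
      refine le_antisymm (Nat.sInf_le hTm) (le_csInf ⟨m, hTm⟩ fun k hk => ?_)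
      have : n x ≤ k + 1 := by
        rw [hn]
        exact Nat.sInf_le ⟨Nat.le_add_left 1 k, hk.2⟩
      omega
    rw [← hmem x, ← hmem (T x), hS x, hS (T x), hTn, hm, iterate_succ_apply]

/-- The induced transformation on a set of positive measure is ergodic with
respect to the conditional probability measure. -/
theorem induced_transformation_ergodic
    {X : Type*} [MeasurableSpace X] (μ : Measure X) [IsProbabilityMeasure μ]
    (T Tinv : X → X) (hTmeas : Measurable T) (hTinvmeas : Measurable Tinv)
    (hTleft : Function.LeftInverse Tinv T) (hTright : Function.RightInverse Tinv T)
    (hTmp : ∀ B : Set X, MeasurableSet B → μ (T ⁻¹' B) = μ B)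
    (hTerg : ∀ B : Set X, MeasurableSet B → T ⁻¹' B = B → μ B = 0 ∨ μ B = 1)
    (A : Set X) (hA : MeasurableSet A) (hApos : 0 < μ A)
    (n : X → ℕ) (hn : ∀ x, n x = sInf {k : ℕ | 1 ≤ k ∧ T^[k] x ∈ A})
    (S : X → X) (hS : ∀ x, S x = T^[n x] x) :
    ∀ B : Set X, MeasurableSet B → S ⁻¹' B = B →
      μ (B ∩ A) / μ A = 0 ∨ μ (B ∩ A) / μ A = 1 := by
  intro B hB hSB
  have hT : Ergodic T μ :=
    { measurable := hTmeas
      map_eq := Measure.ext fun s hs => by rw [Measure.map_apply hTmeas hs, hTmp s hs]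
      aeconst_set := fun s hs hinv => by
        rw [Filter.eventuallyConst_set', ae_eq_empty, ae_eq_univ, prob_compl_eq_zero_iff hs]
        exact hTerg s hs hinv }
  have hle : B ≤ᵐ[μ] T ⁻¹' B := by
    filter_upwards [hT.ae_exists_iterate_mem hA hApos] with x hx
    exact (mem_iff_apply_mem_of_induced_invariant hn hS hSB hx).2
  rcases hT.ae_empty_or_univ_of_ae_le_preimage hB.nullMeasurableSet hle with h | h
  · left
    rw [measure_mono_null inter_subset_left (ae_eq_empty.1 h), ENNReal.zero_div]
  · right
    rw [measure_congr (h.inter (ae_eq_refl A)), univ_inter]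
    exact ENNReal.div_self hApos.ne' (measure_ne_top μ A)
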